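/- arXiv:2206.05906 — 2 statements merged into one kernel-verified Lean document; each statement's English description precedes it below -/
import Mathlib

section
/- Let k be a field of characteristic zero and D an irreducible homogeneous triangularizable locally nilpotent derivation of degree d ≥ 0 on B = k[U,V,W], with kernel A. Let X be a linear variable of B with X ∈ ker(D) (as in the triangular form of D). Then for every n ∈ ℕ, writing n = t(d+2) + r with 0 ≤ r ≤ d+1, the n-th image ideal satisfies I_n = D^n(B) ∩ A = (X^{t(d+1)² + r(d+1)}) = (X^{nd + t + r}) as an ideal of A. -/
/-- A derivation is locally nilpotent if every element is killed by some iterate. -/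
def IsLND {k B : Type*} [CommRing k] [CommRing B] [Algebra k B]
    (D : Derivation k B B) : Prop :=
  ∀ b : B, ∃ n : ℕ, (⇑D)^[n] b = 0

/-- `ndeg D b n` says that `n` is the `D`-degree of `b`, i.e. the largest `m` with
`D^[m] b ≠ 0`. -/
def ndeg {k B : Type*} [CommRing k] [CommRing B] [Algebra k B]
    (D : Derivation k B B) (b : B) (n : ℕ) : Prop :=
  (⇑D)^[n] b ≠ 0 ∧ (⇑D)^[n + 1] b = 0

/-- A derivation is irreducible if the ideal generated by its image is not contained
in any proper principal ideal. -/
def IsIrred {k B : Type*} [CommRing k] [CommRing B] [Algebra k B]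
    (D : Derivation k B B) : Prop :=
  ∀ b : B, Ideal.span (Set.range (⇑D)) ≤ Ideal.span {b} → IsUnit b

open MvPolynomial

/-- The Jacobian derivation `g ↦ ∂(f₁,f₂,g)/∂(X₀,X₁,X₂)` on `k[X₀,X₁,X₂]`. -/
noncomputable def jac {k : Type*} [CommRing k]
    (f₁ f₂ g : MvPolynomial (Fin 3) k) : MvPolynomial (Fin 3) k :=
  Matrix.det (Matrix.of fun i j => MvPolynomial.pderiv j (![f₁, f₂, g] i))

/-- `V 0, V 1, V 2` form a system of coordinates (variables) of `k[X₀,X₁,X₂]`. -/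
def IsCoordSys {k : Type*} [CommRing k]
    (V : Fin 3 → MvPolynomial (Fin 3) k) : Prop :=
  ∃ σ : MvPolynomial (Fin 3) k ≃ₐ[k] MvPolynomial (Fin 3) k,
    ∀ i, σ (X i) = V i

/-- `D` is homogeneous of degree `d` with respect to the standard grading. -/
def IsHomogDer {k : Type*} [CommRing k]
    (D : Derivation k (MvPolynomial (Fin 3) k) (MvPolynomial (Fin 3) k))
    (d : ℕ) : Prop :=
  ∀ (i : ℕ) (f : MvPolynomial (Fin 3) k),
    f.IsHomogeneous i → (D f).IsHomogeneous (i + d)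

/-- `D` has rank 2: some coordinate system has its last variable in the kernel, but no
coordinate system has its last two variables in the kernel. -/
def HasRank2 {k : Type*} [CommRing k]
    (D : Derivation k (MvPolynomial (Fin 3) k) (MvPolynomial (Fin 3) k)) : Prop :=
  (∃ V : Fin 3 → MvPolynomial (Fin 3) k, IsCoordSys V ∧ D (V 2) = 0) ∧
  ¬ (∃ V : Fin 3 → MvPolynomial (Fin 3) k, IsCoordSys V ∧ D (V 1) = 0 ∧ D (V 2) = 0)

/-- `D` is triangularizable: in some coordinate system `{X,Y,Z}` one has `D X ∈ k`,
`D Y ∈ k[X]`, `D Z ∈ k[X,Y]`. -/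
def IsTriangularizable {k : Type*} [CommRing k]
    (D : Derivation k (MvPolynomial (Fin 3) k) (MvPolynomial (Fin 3) k)) : Prop :=
  ∃ V : Fin 3 → MvPolynomial (Fin 3) k, IsCoordSys V ∧
    (∃ c : k, D (V 0) = C c) ∧
    D (V 1) ∈ Algebra.adjoin k ({V 0} : Set (MvPolynomial (Fin 3) k)) ∧
    D (V 2) ∈ Algebra.adjoin k ({V 0, V 1} : Set (MvPolynomial (Fin 3) k))


namespace ImgIdeals

section core

set_option linter.unusedSectionVars false

variable {k B : Type*} [Field k] [CharZero k] [CommRing B] [IsDomain B] [Algebra k B]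

/-- The kernel of a derivation as a subalgebra. -/
def kerAlg (D : Derivation k B B) : Subalgebra k B where
  carrier := {b | D b = 0}
  mul_mem' := by
    intro a b ha hb
    simp only [Set.mem_ofPred_eq] at *
    simp [ha, hb]
  add_mem' := by
    intro a b ha hb
    simp only [Set.mem_ofPred_eq] at *
    simp [ha, hb]
  algebraMap_mem' := by
    intro r
    simp

lemma mem_kerAlg {D : Derivation k B B} {b : B} : b ∈ kerAlg D ↔ D b = 0 := Iff.rfl

lemma iter_mul_ker (D : Derivation k B B) {a : B} (ha : D a = 0) (n : ℕ) (b : B) :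
    (⇑D)^[n] (a * b) = a * (⇑D)^[n] b := by
  induction n generalizing b with
  | zero => rfl
  | succ n ih =>
    rw [Function.iterate_succ_apply, Function.iterate_succ_apply, ← ih]
    simp [ha]

lemma iter_add (D : Derivation k B B) (n : ℕ) (a b : B) :
    (⇑D)^[n] (a + b) = (⇑D)^[n] a + (⇑D)^[n] b := iterate_map_add D n a b

lemma iter_zero (D : Derivation k B B) (n : ℕ) :
    (⇑D)^[n] (0 : B) = 0 := iterate_map_zero D n

lemma iter_sum (D : Derivation k B B) (n : ℕ) {ι : Type*} (s : Finset ι) (f : ι → B) :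
    (⇑D)^[n] (∑ i ∈ s, f i) = ∑ i ∈ s, (⇑D)^[n] (f i) := by
  classical
  induction s using Finset.induction_on with
  | empty => simp
  | insert a s ha ih => rw [Finset.sum_insert ha, Finset.sum_insert ha, iter_add, ih]

lemma iter_gt (D : Derivation k B B) {n m : ℕ} {b v : B} (h : (⇑D)^[n] b = v) (hv : D v = 0)
    (hm : n < m) : (⇑D)^[m] b = 0 := by
  obtain ⟨j, rfl⟩ := Nat.exists_eq_add_of_lt hm
  rw [show n + j + 1 = j + (n + 1) by ring, Function.iterate_add_apply,
    Function.iterate_succ_apply', h, hv, iter_zero]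

lemma leib (D : Derivation k B B) (s : ℕ) : ∀ (n m : ℕ) (b b' v w : B), n + m = s →
    (⇑D)^[n] b = v → D v = 0 → (⇑D)^[m] b' = w → D w = 0 →
    ∃ N : ℕ, 0 < N ∧ (⇑D)^[n + m] (b * b') = (N : B) * (v * w) := by
  induction s with
  | zero =>
    intro n m b b' v w hs hb hv hb' hw
    obtain ⟨rfl, rfl⟩ : n = 0 ∧ m = 0 := by omega
    exact ⟨1, one_pos, by simp at *; rw [hb, hb']⟩
  | succ s ih =>
    intro n m b b' v w hs hb hv hb' hw
    rcases n with _ | n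
    · refine ⟨1, one_pos, ?_⟩
      simp only [Function.iterate_zero, id] at hb
      subst hb
      rw [iter_mul_ker D hv, zero_add, hb']; simp
    rcases m with _ | m
    · refine ⟨1, one_pos, ?_⟩
      simp only [Function.iterate_zero, id] at hb'
      subst hb'
      rw [mul_comm, iter_mul_ker D hw, add_zero, hb]; push_cast; ring
    obtain ⟨N1, h1, e1⟩ := ih n (m+1) (D b) b' v w (by omega) (by simpa using hb) hv hb' hw
    obtain ⟨N2, h2, e2⟩ := ih (n+1) m b (D b') v w (by omega) hb hv (by simpa using hb') hw
    refine ⟨N1 + N2, by omega, ?_⟩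
    rw [show n + 1 + (m + 1) = (n + (m + 1)) + 1 by ring, Function.iterate_succ_apply,
      Derivation.leibniz, smul_eq_mul, smul_eq_mul, iter_add, mul_comm b' (D b), e1,
      show n + (m+1) = n + 1 + m by ring, e2]
    push_cast; ring

/-- `D^n b` is a nonzero scalar times `x^e`. -/
def RR (D : Derivation k B B) (x : B) (n e : ℕ) (b : B) : Prop :=
  ∃ u : k, u ≠ 0 ∧ (⇑D)^[n] b = algebraMap k B u * x ^ e

lemma D_ux {D : Derivation k B B} {x : B} (hx : D x = 0) (u : k) (e : ℕ) :
    D (algebraMap k B u * x ^ e) = 0 := by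
  have h1 : algebraMap k B u ∈ kerAlg D := (kerAlg D).algebraMap_mem u
  have h2 : x ^ e ∈ kerAlg D := (kerAlg D).pow_mem hx e
  exact (kerAlg D).mul_mem h1 h2

lemma RR_mul {D : Derivation k B B} {x : B} (hx : D x = 0) {n e m f : ℕ} {b b' : B}
    (h : RR D x n e b) (h' : RR D x m f b') : RR D x (n + m) (e + f) (b * b') := by
  obtain ⟨u, hu, e1⟩ := h
  obtain ⟨u', hu', e2⟩ := h'
  obtain ⟨N, hN, e3⟩ := leib D (n + m) n m b b' _ _ rfl e1 (D_ux hx _ _) e2 (D_ux hx _ _)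
  refine ⟨N * (u * u'), ?_, ?_⟩
  · have : (N : k) ≠ 0 := by exact_mod_cast hN.ne'
    positivity
  · rw [e3]; simp only [map_mul, map_natCast]; ring

lemma RR_one {D : Derivation k B B} {x : B} : RR D x 0 0 (1 : B) := ⟨1, one_ne_zero, by simp⟩

lemma RR_pow {D : Derivation k B B} {x : B} (hx : D x = 0) {n e : ℕ} {b : B}
    (h : RR D x n e b) (j : ℕ) : RR D x (j * n) (j * e) (b ^ j) := by
  induction j with
  | zero => simpa using RR_one
  | succ j ih =>
    rw [pow_succ, Nat.succ_mul, Nat.succ_mul]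
    exact RR_mul hx ih h

lemma RR_gt {D : Derivation k B B} {x : B} (hx : D x = 0) {n e m : ℕ} {b : B}
    (h : RR D x n e b) (hm : n < m) : (⇑D)^[m] b = 0 := by
  obtain ⟨u, hu, e1⟩ := h
  exact iter_gt D e1 (D_ux hx _ _) hm

variable (D : Derivation k B B) (d : ℕ) (x y z : B) (c : k) (q : ℕ → k)

lemma RR_y (hc : c ≠ 0) (hy : D y = algebraMap k B c * x ^ (d + 1)) :
    RR D x 1 (d + 1) y := ⟨c, hc, by simpa using hy⟩

lemma RR_z (hx : D x = 0) (hc : c ≠ 0) (hy : D y = algebraMap k B c * x ^ (d + 1))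
    (hq : q (d + 1) ≠ 0)
    (hz : D z = ∑ i ∈ Finset.range (d + 2), algebraMap k B (q i) * x ^ (d + 1 - i) * y ^ i) :
    RR D x (d + 2) ((d + 1) ^ 2) z := by
  have hyj := RR_pow hx (RR_y D d x y c hc hy)
  have key : (⇑D)^[d + 2] z = algebraMap k B (q (d + 1)) * (⇑D)^[d + 1] (y ^ (d + 1)) := by
    rw [Function.iterate_succ_apply, hz, iter_sum, Finset.sum_range_succ, Finset.sum_eq_zero]
    · rw [iter_mul_ker D (D_ux hx _ _)]; simp
    · intro i hi
      rw [iter_mul_ker D (D_ux hx _ _), RR_gt hx (hyj i) (by simpa using hi), mul_zero]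
  obtain ⟨u, hu, e1⟩ := hyj (d + 1)
  rw [mul_one] at e1
  exact ⟨q (d + 1) * u, mul_ne_zero hq hu, by rw [key, e1, map_mul]; ring⟩

/-- the basis elements -/
def bn (d : ℕ) (y z : B) (n : ℕ) : B := z ^ (n / (d + 2)) * y ^ (n % (d + 2))

lemma RR_bn (hx : D x = 0) (hc : c ≠ 0) (hy : D y = algebraMap k B c * x ^ (d + 1))
    (hq : q (d + 1) ≠ 0)
    (hz : D z = ∑ i ∈ Finset.range (d + 2), algebraMap k B (q i) * x ^ (d + 1 - i) * y ^ i)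
    (n : ℕ) :
    RR D x n ((n / (d + 2)) * (d + 1) ^ 2 + (n % (d + 2)) * (d + 1)) (bn d y z n) := by
  have h := RR_mul hx (RR_pow hx (RR_z D d x y z c q hx hc hy hq hz) (n / (d + 2)))
    (RR_pow hx (RR_y D d x y c hc hy) (n % (d + 2)))
  rwa [mul_one, Nat.div_add_mod'] at h

lemma exists_P (hx : D x = 0) (hc : c ≠ 0) (hy : D y = algebraMap k B c * x ^ (d + 1))
    (hq : q (d + 1) ≠ 0)
    (hz : D z = ∑ i ∈ Finset.range (d + 2), algebraMap k B (q i) * x ^ (d + 1 - i) * y ^ i) :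
    ∃ (P : B) (G : MvPolynomial (Fin 3) k), D P = 0 ∧ G.totalDegree ≤ d + 1 ∧
      y ^ (d + 2) = P + x * aeval ![x, y, z] G := by
  set g : MvPolynomial (Fin 3) k :=
    ∑ i ∈ Finset.range (d + 1), C (q i / (i + 1)) * X 0 ^ (d - i) * X 1 ^ (i + 1)
      - C c * X 0 ^ d * X 2 with hg
  set Q : B := ∑ i ∈ Finset.range (d + 2),
    algebraMap k B (q i / (i + 1)) * x ^ (d + 1 - i) * y ^ (i + 1)
      - algebraMap k B c * x ^ (d + 1) * z with hQ
  set r : k := (q (d + 1) / ((d + 1 : ℕ) + 1)) with hr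
  have hr0 : r ≠ 0 := div_ne_zero hq (Nat.cast_add_one_ne_zero _)
  have hgdeg : g.totalDegree ≤ d + 1 := by
    refine MvPolynomial.IsHomogeneous.totalDegree_le ?_
    refine MvPolynomial.IsHomogeneous.sub ?_ ?_
    · refine MvPolynomial.IsHomogeneous.sum _ _ _ ?_
      intro i hi
      have := ((isHomogeneous_C_mul_X_pow (q i / (i + 1)) (0 : Fin 3) (d - i)).mul
        (isHomogeneous_X_pow (R := k) (1 : Fin 3) (i + 1)))
      rwa [show d - i + (i + 1) = d + 1 by simp at hi; omega] at this
    · exact (isHomogeneous_C_mul_X_pow c (0 : Fin 3) d).mul (isHomogeneous_X k 2)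
  have hQx : Q = algebraMap k B r * y ^ (d + 2) + x * aeval ![x, y, z] g := by
    have e1 : aeval ![x, y, z] g = ∑ i ∈ Finset.range (d + 1),
        algebraMap k B (q i / (i + 1)) * x ^ (d - i) * y ^ (i + 1)
        - algebraMap k B c * x ^ d * z := by
      simp [hg]
    rw [e1, hQ, Finset.sum_range_succ, mul_sub, Finset.mul_sum]
    have e2 : ∀ i ∈ Finset.range (d + 1),
        x * (algebraMap k B (q i / (i + 1)) * x ^ (d - i) * y ^ (i + 1))
        = algebraMap k B (q i / (i + 1)) * x ^ (d + 1 - i) * y ^ (i + 1) := by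
      intro i hi
      rw [show d + 1 - i = d - i + 1 by simp at hi; omega]; ring
    rw [Finset.sum_congr rfl e2, hr]
    simp only [Nat.sub_self, pow_zero]
    ring
  have hDQ : D Q = 0 := by
    rw [hQ, map_sub, map_sum, Derivation.leibniz, D_ux hx, hz, smul_zero, add_zero, smul_eq_mul,
      Finset.mul_sum, sub_eq_zero]
    refine Finset.sum_congr rfl fun i hi => ?_
    rw [Derivation.leibniz, D_ux hx, smul_zero, add_zero, Derivation.leibniz_pow, hy]
    have : algebraMap k B (q i) = algebraMap k B (q i / (i + 1)) * ((i + 1 : ℕ) : B) := by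
      rw [← map_natCast (algebraMap k B), ← map_mul]
      congr 1
      have : (i + 1 : k) ≠ 0 := by exact_mod_cast Nat.succ_ne_zero i
      push_cast
      field_simp
    rw [this]
    simp only [smul_eq_mul, nsmul_eq_mul, Nat.add_sub_cancel]
    ring
  have hinv : algebraMap k B r⁻¹ * algebraMap k B r = 1 := by
    rw [← map_mul, inv_mul_cancel₀ hr0, map_one]
  refine ⟨algebraMap k B r⁻¹ * Q, - (C r⁻¹ * g), ?_, ?_, ?_⟩
  · exact (kerAlg D).mul_mem ((kerAlg D).algebraMap_mem _) hDQ
  · rw [totalDegree_neg]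
    refine (totalDegree_mul _ _).trans ?_
    simpa using hgdeg
  · rw [hQx]
    simp only [map_neg, map_mul, aeval_C]
    linear_combination (-y ^ (d + 2)) * hinv

lemma span_all (hx : D x = 0) (hc : c ≠ 0) (hy : D y = algebraMap k B c * x ^ (d + 1))
    (hq : q (d + 1) ≠ 0)
    (hz : D z = ∑ i ∈ Finset.range (d + 2), algebraMap k B (q i) * x ^ (d + 1 - i) * y ^ i)
    (m : ℕ) : ∀ f : MvPolynomial (Fin 3) k, f.totalDegree < m →
      aeval ![x, y, z] f ∈ Submodule.span (kerAlg D) (Set.range (bn d y z)) := by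
  obtain ⟨P, G, hP, hG, hPG⟩ := exists_P D d x y z c q hx hc hy hq hz
  set S := Submodule.span (kerAlg D) (Set.range (bn d y z)) with hS
  have smem : ∀ a b : B, D a = 0 → b ∈ S → a * b ∈ S := fun a b ha hb =>
    S.smul_mem (⟨a, ha⟩ : kerAlg D) hb
  induction m with
  | zero => intro f hf; omega
  | succ m ih =>
    have mono : ∀ i j l : ℕ, i + j + l ≤ m → x ^ i * y ^ j * z ^ l ∈ S := by
      have tdeg : ∀ i j l : ℕ,
          (X 0 ^ i * X 1 ^ j * X 2 ^ l : MvPolynomial (Fin 3) k).totalDegree ≤ i + j + l := by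
        intro i j l
        exact (((isHomogeneous_X_pow (R := k) (0 : Fin 3) i).mul
          (isHomogeneous_X_pow (1 : Fin 3) j)).mul (isHomogeneous_X_pow (2 : Fin 3) l)).totalDegree_le
      intro i j l hm
      rcases i with _ | i
      · by_cases hj : j < d + 2
        · refine Submodule.subset_span ⟨l * (d + 2) + j, ?_⟩
          have h1 : (l * (d + 2) + j) / (d + 2) = l := by
            rw [mul_comm, Nat.mul_add_div (by omega), Nat.div_eq_of_lt hj, add_zero]
          have h2 : (l * (d + 2) + j) % (d + 2) = j := by
            rw [mul_comm, Nat.mul_add_mod, Nat.mod_eq_of_lt hj]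
          simp only [bn, h1, h2]
          ring
        · obtain ⟨j, rfl⟩ := Nat.exists_eq_add_of_le (not_lt.mp hj)
          have h1 := ih (X 0 ^ 0 * X 1 ^ j * X 2 ^ l) (lt_of_le_of_lt (tdeg _ _ _) (by omega))
          have h2 := ih (G * (X 0 ^ 0 * X 1 ^ j * X 2 ^ l))
            (lt_of_le_of_lt (totalDegree_mul _ _) (by have := tdeg 0 j l; omega))
          have := S.add_mem (smem _ _ hP h1) (smem _ _ hx h2)
          convert this using 1
          rw [pow_add, hPG]
          simp
          ring
      · have h1 := ih (X 0 ^ i * X 1 ^ j * X 2 ^ l) (lt_of_le_of_lt (tdeg _ _ _) (by omega))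
        convert smem _ _ hx h1 using 1
        simp
        ring
    intro f hf
    rw [f.as_sum, map_sum]
    refine S.sum_mem fun s hs => ?_
    rw [aeval_monomial]
    refine smem _ _ (by simp) ?_
    rw [Finsupp.prod_fintype _ _ (by simp), Fin.prod_univ_three]
    refine mono _ _ _ ?_
    have := le_totalDegree hs
    rw [Finsupp.sum_fintype _ _ (by simp), Fin.sum_univ_three] at this
    omega

lemma decomp_div (hx : D x = 0) (hx0 : x ≠ 0) (e : ℕ → ℕ) (w : ℕ → B)
    (hw : ∀ n, RR D x n (e n) (w n)) (a : ℕ → B) (ha : ∀ n, D (a n) = 0) (N : ℕ) :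
    ∀ n, (⇑D)^[n + 1] (∑ i ∈ Finset.range N, a i * w i) = 0 →
      ∃ c', D c' = 0 ∧ (⇑D)^[n] (∑ i ∈ Finset.range N, a i * w i) = x ^ e n * c' := by
  have low : ∀ N n, N ≤ n → (⇑D)^[n] (∑ i ∈ Finset.range N, a i * w i) = 0 := by
    intro N n h
    rw [iter_sum]
    refine Finset.sum_eq_zero fun i hi => ?_
    rw [iter_mul_ker D (ha i), RR_gt hx (hw i) (by simp at hi; omega), mul_zero]
  induction N with
  | zero => intro n _; exact ⟨0, by simp, by simp⟩
  | succ N ih =>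
    intro n h
    obtain ⟨u, hu, e1⟩ := hw N
    rcases lt_trichotomy n N with h1 | h1 | h1
    · have h2 : (⇑D)^[N] (∑ i ∈ Finset.range (N + 1), a i * w i) = 0 :=
        by
          obtain ⟨j, rfl⟩ := Nat.exists_eq_add_of_lt h1
          rw [show n + j + 1 = j + (n + 1) by ring] at *
          rw [Function.iterate_add_apply, h, iter_zero]
      rw [Finset.sum_range_succ, iter_add, low N N le_rfl, zero_add, iter_mul_ker D (ha N), e1] at h2
      have h3 : a N = 0 := by
        rcases mul_eq_zero.mp h2 with h3 | h3
        · exact h3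
        · exfalso
          rcases mul_eq_zero.mp h3 with h4 | h4
          · exact hu (by simpa using h4)
          · exact hx0 (eq_zero_of_pow_eq_zero h4)
      rw [Finset.sum_range_succ, h3, zero_mul, add_zero] at h ⊢
      exact ih n h
    · subst h1
      refine ⟨a n * algebraMap k B u, (kerAlg D).mul_mem (ha n) ((kerAlg D).algebraMap_mem _), ?_⟩
      rw [Finset.sum_range_succ, iter_add, low n n le_rfl, zero_add, iter_mul_ker D (ha n), e1]
      ring
    · exact ⟨0, by simp, by rw [low _ _ h1, mul_zero]⟩

theorem core (hx : D x = 0) (hx0 : x ≠ 0) (hc : c ≠ 0)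
    (hy : D y = algebraMap k B c * x ^ (d + 1)) (hq : q (d + 1) ≠ 0)
    (hz : D z = ∑ i ∈ Finset.range (d + 2), algebraMap k B (q i) * x ^ (d + 1 - i) * y ^ i)
    (hsurj : Function.Surjective (aeval (R := k) ![x, y, z])) (n : ℕ) :
    {v | (∃ b, (⇑D)^[n] b = v) ∧ D v = 0}
          = {v | ∃ c, D c = 0 ∧
              v = x ^ ((n / (d + 2)) * (d + 1) ^ 2 + (n % (d + 2)) * (d + 1)) * c} := by
  have hb := RR_bn D d x y z c q hx hc hy hq hz
  ext v
  simp only [Set.mem_ofPred_eq]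
  constructor
  · rintro ⟨⟨b, rfl⟩, hv⟩
    obtain ⟨f, rfl⟩ := hsurj b
    have := span_all D d x y z c q hx hc hy hq hz _ f (Nat.lt_succ_self _)
    obtain ⟨a, ha⟩ := Finsupp.mem_span_range_iff_exists_finsupp.mp this
    have hsum : (aeval ![x, y, z]) f =
        ∑ i ∈ Finset.range (a.support.sup id + 1), (a i : B) * bn d y z i := by
      rw [← ha, Finsupp.sum]
      refine Finset.sum_subset ?_ ?_
      · intro i hi
        simpa using Nat.lt_succ_of_le (Finset.le_sup (f := id) hi)
      · intro i _ hi
        simp [Finsupp.notMem_support_iff.mp hi]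
    rw [← Function.iterate_succ_apply' (f := ⇑D)] at hv
    rw [hsum] at hv ⊢
    exact decomp_div D x hx hx0 _ _ hb (fun i => (a i : B)) (fun i => (a i).2) _ n hv
  · rintro ⟨r, hr, rfl⟩
    obtain ⟨u, hu, e1⟩ := hb n
    refine ⟨⟨algebraMap k B u⁻¹ * r * bn d y z n, ?_⟩, ?_⟩
    · rw [iter_mul_ker D ((kerAlg D).mul_mem ((kerAlg D).algebraMap_mem _) hr), e1]
      have hinv : algebraMap k B u⁻¹ * algebraMap k B u = 1 := by
        rw [← map_mul, inv_mul_cancel₀ hu, map_one]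
      linear_combination (r * x ^ ((n / (d + 2)) * (d + 1) ^ 2 + (n % (d + 2)) * (d + 1))) * hinv
    · exact (kerAlg D).mul_mem ((kerAlg D).pow_mem hx _) hr

end core

section lin

variable {k : Type*} [Field k]

local notation "BB" => MvPolynomial (Fin 3) k
local notation "II" => idealOfVars (Fin 3) k

lemma mem_I_iff (f : BB) : f ∈ II ↔ constantCoeff f = 0 := by
  have := mem_pow_idealOfVars_iff' 1 f
  rw [pow_one] at this
  rw [this]
  constructor
  · intro h; exact h 0 (by simp)
  · intro h s hs
    have : s = 0 := by simpa [Finsupp.degree_eq_zero_iff] using hs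
    subst this; exact h

lemma comp_zero_of_mem {f : BB} {m : ℕ} (h : f ∈ II ^ (m + 1)) :
    homogeneousComponent m f = 0 := by
  apply homogeneousComponent_eq_zero'
  intro s hs
  have := (mem_pow_idealOfVars_iff _ _).mp h s hs
  omega

lemma homog_mem {f : BB} {m : ℕ} (h : f.IsHomogeneous m) : f ∈ II ^ m := by
  rw [mem_pow_idealOfVars_iff']
  intro s hs
  exact h.coeff_eq_zero hs.ne

lemma sub_comp_mem {f : BB} {m : ℕ} (h : f ∈ II ^ m) :
    f - homogeneousComponent m f ∈ II ^ (m + 1) := by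
  rw [mem_pow_idealOfVars_iff'] at *
  intro s hs
  rw [coeff_sub, coeff_homogeneousComponent]
  split_ifs with h1
  · simp
  · rw [h s (by omega)]; simp

/-- `g` is the degree `j` part of `f`, of order at least `j`. -/
def QQ (j : ℕ) (f g : BB) : Prop := f - g ∈ II ^ (j + 1) ∧ g ∈ II ^ j

lemma QQ_mem {j : ℕ} {f g : BB} (h : QQ j f g) : f ∈ II ^ j := by
  have := (II ^ j).add_mem (Ideal.pow_le_pow_right (Nat.le_succ j) h.1) h.2
  simpa using this

lemma QQ_mul {i j : ℕ} {f g f' g' : BB} (h : QQ i f g) (h' : QQ j f' g') :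
    QQ (i + j) (f * f') (g * g') := by
  refine ⟨?_, ?_⟩
  · have h1 := Ideal.mul_mem_mul h.1 (QQ_mem h')
    have h2 := Ideal.mul_mem_mul h.2 h'.1
    rw [← pow_add] at h1 h2
    rw [show i + 1 + j = i + j + 1 by ring] at h1
    rw [show i + (j + 1) = i + j + 1 by ring] at h2
    convert (II ^ (i + j + 1)).add_mem h1 h2 using 1
    ring
  · rw [pow_add]; exact Ideal.mul_mem_mul h.2 h'.2

lemma QQ_pow {i : ℕ} {f g : BB} (h : QQ i f g) (n : ℕ) :
    QQ (n * i) (f ^ n) (g ^ n) := by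
  induction n with
  | zero => simp [QQ]
  | succ n ih => rw [pow_succ, pow_succ, Nat.succ_mul]; exact QQ_mul ih h

lemma QQ_aeval {V L : Fin 3 → BB} (h : ∀ i, QQ 1 (V i) (L i)) {f : BB} {m : ℕ}
    (hf : f.IsHomogeneous m) : QQ m (aeval V f) (aeval L f) := by
  have key : ∀ s ∈ f.support, QQ m (aeval V (monomial s (coeff s f)))
      (aeval L (monomial s (coeff s f))) := by
    intro s hs
    have hdeg : s.degree = m := by
      by_contra h0
      exact (mem_support_iff.mp hs) (hf.coeff_eq_zero h0)
    rw [aeval_monomial, aeval_monomial, Finsupp.prod_fintype _ _ (by simp),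
      Finsupp.prod_fintype _ _ (by simp), Fin.prod_univ_three, Fin.prod_univ_three]
    have h1 := QQ_mul (QQ_mul (QQ_pow (h 0) (s 0)) (QQ_pow (h 1) (s 1))) (QQ_pow (h 2) (s 2))
    have h2 : QQ 0 (algebraMap k BB (coeff s f)) (algebraMap k BB (coeff s f)) := by
      simp [QQ]
    have h3 := QQ_mul h2 h1
    have h4 : 0 + (s 0 * 1 + s 1 * 1 + s 2 * 1) = m := by
      rw [← hdeg, Finsupp.degree_eq_sum, Fin.sum_univ_three]; ring
    rwa [h4] at h3
  refine ⟨?_, ?_⟩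
  · have := Ideal.sum_mem _ fun s hs => (key s hs).1
    rw [Finset.sum_sub_distrib, ← map_sum, ← map_sum, ← f.as_sum] at this
    exact this
  · have := Ideal.sum_mem _ fun s hs => (key s hs).2
    rw [← map_sum, ← f.as_sum] at this
    exact this

lemma alg_I {φ : BB →ₐ[k] BB} (h : ∀ i, constantCoeff (φ (X i)) = 0) {f : BB} {m : ℕ}
    (hf : f ∈ II ^ m) : φ f ∈ II ^ m := by
  have h1 : Ideal.map φ.toRingHom (II) ≤ II := by
    rw [idealOfVars, Ideal.map_span, Ideal.span_le]
    rintro _ ⟨_, ⟨i, rfl⟩, rfl⟩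
    exact (mem_I_iff _).mpr (h i)
  have h2 := Ideal.mem_map_of_mem φ.toRingHom hf
  rw [Ideal.map_pow] at h2
  exact Ideal.pow_right_mono h1 m h2

lemma alg_const {φ : BB →ₐ[k] BB} (h : ∀ i, constantCoeff (φ (X i)) = 0) (f : BB) :
    constantCoeff (φ f) = constantCoeff f := by
  have h1 : f - C (constantCoeff f) ∈ II ^ 1 := by
    rw [pow_one, mem_I_iff]; simp
  have h2 := alg_I h h1
  rw [pow_one, mem_I_iff, map_sub, map_sub, sub_eq_zero] at h2
  rw [h2, ← algebraMap_eq, AlgHom.commutes, algebraMap_eq, constantCoeff_C]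

lemma symm_const {σ : BB ≃ₐ[k] BB} (h : ∀ i, constantCoeff (σ (X i)) = 0) (i : Fin 3) :
    constantCoeff (σ.symm (X i)) = 0 := by
  have := alg_const (φ := (σ : BB →ₐ[k] BB)) h (σ.symm (X i))
  simpa using this.symm

/-- Initial form lemma. -/
lemma init_form {σ : BB ≃ₐ[k] BB} (h : ∀ i, constantCoeff (σ (X i)) = 0) {g : BB} {m : ℕ}
    (hg : g ∈ II ^ m) :
    homogeneousComponent m g =
      aeval (fun i => homogeneousComponent 1 (σ (X i))) (homogeneousComponent m (σ.symm g)) := by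
  set L : Fin 3 → BB := fun i => homogeneousComponent 1 (σ (X i)) with hL
  have hq : ∀ i, QQ 1 (σ (X i)) (L i) := fun i =>
    ⟨sub_comp_mem (by rw [pow_one, mem_I_iff]; exact h i),
      homog_mem (homogeneousComponent_isHomogeneous _ _)⟩
  set f := σ.symm g with hf
  have hfm : f ∈ II ^ m := alg_I (φ := (σ.symm : BB →ₐ[k] BB)) (symm_const h) hg
  have hσ : ∀ p : BB, aeval (fun i => σ (X i)) p = σ p := by
    intro p
    have : aeval (fun i => σ (X i)) = (σ : BB →ₐ[k] BB) := by
      apply MvPolynomial.algHom_ext; intro i; simp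
    rw [this]; rfl
  have h1 := QQ_aeval hq (homogeneousComponent_isHomogeneous m f)
  rw [hσ] at h1
  have h2 : σ (f - homogeneousComponent m f) ∈ II ^ (m + 1) :=
    alg_I (φ := (σ : BB →ₐ[k] BB)) h (sub_comp_mem hfm)
  have h3 := (II ^ (m + 1)).add_mem h1.1 h2
  rw [map_sub, hf, AlgEquiv.apply_symm_apply, ← hf] at h3
  have h4 := comp_zero_of_mem h3
  have h5 : homogeneousComponent m (aeval L (homogeneousComponent m f))
      = aeval L (homogeneousComponent m f) := by
    apply homogeneousComponent_eq_self
    have := (homogeneousComponent_isHomogeneous m f).aeval L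
      (n := 1) (fun i => homogeneousComponent_isHomogeneous _ _)
    rwa [one_mul] at this
  rw [sub_add_sub_comm, add_comm (σ _) g, add_sub_add_comm] at h4
  rw [map_add, map_sub, h5] at h4
  simp only [sub_self, map_zero, add_zero] at h4
  exact sub_eq_zero.mp h4

lemma der_comp {d : ℕ} {D : Derivation k BB BB} (hhom : IsHomogDer D d) (i : ℕ) (f : BB) :
    D (homogeneousComponent i f) = homogeneousComponent (i + d) (D f) := by
  conv_rhs => rw [← sum_homogeneousComponent f, map_sum, map_sum]
  have h1 : ∀ j, homogeneousComponent (i + d) (D (homogeneousComponent j f))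
      = if i = j then D (homogeneousComponent i f) else 0 := by
    intro j
    rw [homogeneousComponent_of_mem (hhom j _ (homogeneousComponent_isHomogeneous j f))]
    by_cases hij : i = j
    · subst hij; simp
    · rw [if_neg (by omega), if_neg hij]
  simp_rw [h1]
  rw [Finset.sum_ite_eq]
  split_ifs with h2
  · rfl
  · rw [homogeneousComponent_eq_zero _ _ (by simp at h2; omega), map_zero]

lemma der_mem {d : ℕ} {D : Derivation k BB BB} (hhom : IsHomogDer D d) {f : BB}  :
    D f ∈ II ^ (d + 1) := by
  rw [← sum_homogeneousComponent f, map_sum]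
  refine Ideal.sum_mem _ fun i _ => ?_
  rcases i with _ | i
  · rw [homogeneousComponent_zero]; simp
  · exact Ideal.pow_le_pow_right (by omega)
      (homog_mem (hhom (i + 1) _ (homogeneousComponent_isHomogeneous _ f)))

lemma comp_pair {m : ℕ} {f : BB} (hf : f ∈ Algebra.adjoin k ({X 0, X 1} : Set BB)) :
    ∃ q : ℕ → k, homogeneousComponent m f =
      ∑ i ∈ Finset.range (m + 1), C (q i) * X 0 ^ (m - i) * X 1 ^ i := by
  rw [← Subalgebra.mem_toSubmodule, Algebra.adjoin_eq_span] at hf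
  induction hf using Submodule.span_induction with
  | mem v hv =>
    obtain ⟨a, b, rfl⟩ := (Submonoid.mem_closure_pair _ _ _).mp hv
    have hh : (X 0 ^ a * X 1 ^ b : BB).IsHomogeneous (a + b) :=
      (isHomogeneous_X_pow 0 a).mul (isHomogeneous_X_pow 1 b)
    rw [homogeneousComponent_of_mem hh]
    split_ifs with h
    · refine ⟨fun i => if b = i then 1 else 0, ?_⟩
      rw [Finset.sum_eq_single b]
      · simp [h]
      · intro i _ hi; simp [hi.symm]
      · intro hb; simp at hb; omega
    · exact ⟨0, by simp⟩
  | zero => exact ⟨0, by simp⟩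
  | add v w _ _ hv hw =>
    obtain ⟨q1, h1⟩ := hv
    obtain ⟨q2, h2⟩ := hw
    refine ⟨q1 + q2, ?_⟩
    rw [map_add, h1, h2, ← Finset.sum_add_distrib]
    refine Finset.sum_congr rfl fun i _ => ?_
    simp; ring
  | smul a v _ hv =>
    obtain ⟨q1, h1⟩ := hv
    refine ⟨a • q1, ?_⟩
    rw [map_smul, h1, Finset.smul_sum]
    refine Finset.sum_congr rfl fun i _ => ?_
    simp [smul_eq_C_mul]; ring

lemma comp_single {m : ℕ} {f : BB} (hf : f ∈ Algebra.adjoin k ({X 0} : Set BB)) :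
    ∃ c : k, homogeneousComponent m f = C c * X 0 ^ m := by
  rw [← Subalgebra.mem_toSubmodule, Algebra.adjoin_eq_span] at hf
  induction hf using Submodule.span_induction with
  | mem v hv =>
    obtain ⟨a, rfl⟩ := Submonoid.mem_closure_singleton.mp hv
    rw [homogeneousComponent_of_mem (isHomogeneous_X_pow 0 a)]
    split_ifs with h
    · exact ⟨1, by simp [h]⟩
    · exact ⟨0, by simp⟩
  | zero => exact ⟨0, by simp⟩
  | add v w _ _ hv hw =>
    obtain ⟨q1, h1⟩ := hv
    obtain ⟨q2, h2⟩ := hw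
    exact ⟨q1 + q2, by rw [map_add, h1, h2]; simp; ring⟩
  | smul a v _ hv =>
    obtain ⟨q1, h1⟩ := hv
    exact ⟨a * q1, by rw [map_smul, h1, smul_eq_C_mul]; simp; ring⟩

lemma norm_tri {D : Derivation k BB BB} (h : IsTriangularizable D) :
    ∃ σ : BB ≃ₐ[k] BB, (∀ i, constantCoeff (σ (X i)) = 0) ∧
      (∃ c : k, D (σ (X 0)) = C c) ∧
      D (σ (X 1)) ∈ Algebra.adjoin k ({σ (X 0)} : Set BB) ∧
      D (σ (X 2)) ∈ Algebra.adjoin k ({σ (X 0), σ (X 1)} : Set BB) := by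
  obtain ⟨V, ⟨σ, hσ⟩, ⟨c, h0⟩, h1, h2⟩ := h
  let v : Fin 3 → k := fun i => constantCoeff (V i)
  let T : BB ≃ₐ[k] BB := AlgEquiv.ofAlgHom (aeval fun i => X i - C (v i))
    (aeval fun i => X i + C (v i))
    (by apply MvPolynomial.algHom_ext; intro i; simp [← algebraMap_eq])
    (by apply MvPolynomial.algHom_ext; intro i; simp [← algebraMap_eq])
  have hT : ∀ i, (T.trans σ) (X i) = V i - C (v i) := by
    intro i
    have : T (X i) = X i - C (v i) := by simp [T]
    rw [AlgEquiv.trans_apply, this, map_sub, hσ, ← algebraMap_eq, AlgEquiv.commutes]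
  have hD : ∀ i, D ((T.trans σ) (X i)) = D (V i) := by
    intro i; rw [hT]; simp
  have hmem : ∀ (i : Fin 3) (A : Subalgebra k BB), (T.trans σ) (X i) ∈ A → V i ∈ A := by
    intro i A hA
    have : V i = (T.trans σ) (X i) + algebraMap k BB (v i) := by
      rw [hT, algebraMap_eq]; ring
    rw [this]
    exact A.add_mem hA (A.algebraMap_mem _)
  refine ⟨T.trans σ, ?_, ⟨c, by rw [hD, h0]⟩, ?_, ?_⟩
  · intro i; rw [hT]; simp [v]
  · rw [hD]
    refine Algebra.adjoin_le ?_ h1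
    rintro _ rfl
    exact hmem 0 _ (Algebra.subset_adjoin rfl)
  · rw [hD]
    refine Algebra.adjoin_le ?_ h2
    rintro _ (rfl | rfl)
    · exact hmem 0 _ (Algebra.subset_adjoin (by simp))
    · exact hmem 1 _ (Algebra.subset_adjoin (by simp))

lemma irr_const {D : Derivation k BB BB} (hirr : IsIrred D) {L : Fin 3 → BB}
    (hs : Function.Surjective (aeval (R := k) L)) (g : BB) (h : ∀ i, g ∣ D (L i)) :
    constantCoeff g ≠ 0 := by
  have hd : ∀ f : BB, g ∣ D (aeval L f) := by
    intro f
    induction f using MvPolynomial.induction_on with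
    | C a => simp
    | add p q hp hq => rw [map_add, map_add]; exact dvd_add hp hq
    | mul_X p i hp =>
      rw [map_mul, aeval_X, Derivation.leibniz]
      exact dvd_add (Dvd.dvd.mul_left (h i) _) (Dvd.dvd.mul_left hp _)
  have hu : IsUnit g := by
    apply hirr
    rw [Ideal.span_le]
    rintro _ ⟨b, rfl⟩
    obtain ⟨f, rfl⟩ := hs b
    exact Ideal.mem_span_singleton.mpr (hd f)
  exact (hu.map (constantCoeff (R := k) (σ := Fin 3))).ne_zero

lemma inj_of_surj (φ : BB →ₐ[k] BB) (hs : Function.Surjective φ) : Function.Injective φ := by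
  have hsn : ∀ n, Function.Surjective ((φ.toRingHom ^ n : BB →+* BB)) := by
    intro n; rw [RingHom.coe_pow]; exact hs.iterate n
  let K : ℕ →o Ideal BB := ⟨fun n => RingHom.ker (φ.toRingHom ^ n : BB →+* BB), by
    refine monotone_nat_of_le_succ fun n a ha => ?_
    rw [RingHom.mem_ker] at *
    rw [pow_succ', RingHom.mul_def, RingHom.comp_apply, ha, map_zero]⟩
  obtain ⟨n, hn⟩ := monotone_stabilizes_iff_noetherian.mpr
    (inferInstance : IsNoetherian BB BB) K
  refine (injective_iff_map_eq_zero φ).mpr fun a ha => ?_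
  obtain ⟨b, rfl⟩ := hsn n a
  have h1 : b ∈ K (n + 1) := by
    change (φ.toRingHom ^ (n + 1) : BB →+* BB) b = 0
    rw [pow_succ', RingHom.mul_def, RingHom.comp_apply]; exact ha
  rw [← hn (n + 1) (Nat.le_succ n)] at h1
  exact h1

end lin

end ImgIdeals

set_option maxHeartbeats 1000000 in
/-- Image ideals of irreducible homogeneous triangularizable LNDs of degree `d` on
`k[U,V,W]`: there is a linear variable `X ∈ ker D` such that for every `n`, writing
`n = t(d+2) + r` with `0 ≤ r ≤ d+1`, the `n`-th image ideal `I_n = D^n(B) ∩ ker D`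
is generated (over `ker D`) by `X^{t(d+1)² + r(d+1)}`. -/
theorem image_ideals_triangularizable {k : Type*} [Field k] [CharZero k]
    (d : ℕ)
    (D : Derivation k (MvPolynomial (Fin 3) k) (MvPolynomial (Fin 3) k))
    (hlnd : IsLND D) (hirr : IsIrred D) (hhom : IsHomogDer D d)
    (htri : IsTriangularizable D) :
    ∃ Xv : MvPolynomial (Fin 3) k,
      (∃ V : Fin 3 → MvPolynomial (Fin 3) k, IsCoordSys V ∧
        (∀ i, (V i).IsHomogeneous 1) ∧ V 0 = Xv) ∧
      D Xv = 0 ∧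
      ∀ n : ℕ,
        {x | (∃ b, (⇑D)^[n] b = x) ∧ D x = 0}
          = {x | ∃ c, D c = 0 ∧
              x = Xv ^ ((n / (d + 2)) * (d + 1) ^ 2 + (n % (d + 2)) * (d + 1)) * c} := by
  obtain ⟨σ, hσ, ⟨c0, h0⟩, h1, h2⟩ := ImgIdeals.norm_tri htri
  set L : Fin 3 → MvPolynomial (Fin 3) k := fun i => homogeneousComponent 1 (σ (X i)) with hL
  have hLh : ∀ i, (L i).IsHomogeneous 1 := fun i => homogeneousComponent_isHomogeneous _ _
  have hLc : ∀ i, constantCoeff (L i) = 0 := fun i =>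
    (ImgIdeals.mem_I_iff _).mp (by simpa using ImgIdeals.homog_mem (hLh i))
  have hsurj : Function.Surjective (aeval (R := k) L) := by
    rw [← AlgHom.range_eq_top, eq_top_iff, ← adjoin_range_X, Algebra.adjoin_le_iff]
    rintro _ ⟨i, rfl⟩
    have h := ImgIdeals.init_form hσ (g := X i) (m := 1)
      (by rw [pow_one, ImgIdeals.mem_I_iff]; simp)
    rw [homogeneousComponent_eq_self (isHomogeneous_X k i)] at h
    exact ⟨_, h.symm⟩
  have hbij : Function.Bijective (aeval (R := k) L) := ⟨ImgIdeals.inj_of_surj _ hsurj, hsurj⟩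
  have hcoord : IsCoordSys L := ⟨AlgEquiv.ofBijective (aeval L) hbij, fun i => by simp⟩
  have hDL : ∀ i, D (L i) = aeval L (homogeneousComponent (d + 1) (σ.symm (D (σ (X i))))) := by
    intro i
    rw [hL]
    simp only
    rw [ImgIdeals.der_comp hhom, add_comm 1 d, ImgIdeals.init_form hσ (ImgIdeals.der_mem hhom)]
  have hx : D (L 0) = 0 := by
    rw [hL]
    simp only
    rw [ImgIdeals.der_comp hhom, h0, homogeneousComponent_of_mem (isHomogeneous_C _ c0), if_neg (by omega)]
  have hadj : ∀ (s : Set (MvPolynomial (Fin 3) k)) f, f ∈ Algebra.adjoin k (σ '' s) →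
      σ.symm f ∈ Algebra.adjoin k s := by
    intro s f hf
    rw [show σ '' s = (σ : _ →ₐ[k] MvPolynomial (Fin 3) k) '' s from rfl,
      ← AlgHom.map_adjoin] at hf
    obtain ⟨g, hg, rfl⟩ := hf
    simpa using hg
  obtain ⟨c, hc⟩ := ImgIdeals.comp_single (m := d + 1) (hadj {X 0} _ (by simpa using h1))
  obtain ⟨q, hq⟩ := ImgIdeals.comp_pair (m := d + 1) (hadj {X 0, X 1} _ (by simpa [Set.image_pair] using h2))
  have hy : D (L 1) = algebraMap k _ c * L 0 ^ (d + 1) := by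
    rw [hDL, hc]; simp
  have hz : D (L 2) = ∑ i ∈ Finset.range (d + 2),
      algebraMap k _ (q i) * L 0 ^ (d + 1 - i) * L 1 ^ i := by
    rw [hDL, hq]; simp
  have hL0 : L 0 ≠ 0 := by
    intro h
    have : (X 0 : MvPolynomial (Fin 3) k) = 0 := hbij.1 (by simp [h])
    exact X_ne_zero _ this
  have hc0 : c ≠ 0 := by
    rintro rfl
    refine ImgIdeals.irr_const hirr hsurj (D (L 2)) ?_ ?_
    · intro i
      fin_cases i
      · simp [hx]
      · simp [hy]
      · simp
    · rw [← ImgIdeals.mem_I_iff]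
      exact Ideal.pow_le_self (Nat.succ_ne_zero d) (ImgIdeals.der_mem hhom)
  have hq0 : q (d + 1) ≠ 0 := by
    intro hq0
    refine ImgIdeals.irr_const hirr hsurj (L 0) ?_ (hLc 0)
    intro i
    fin_cases i
    · simp [hx]
    · simp only [Fin.mk_one, hy]
      exact Dvd.dvd.mul_left (dvd_pow_self _ (by omega)) _
    · change L 0 ∣ D (L 2)
      rw [hz, Finset.sum_range_succ, hq0]
      simp only [map_zero, zero_mul, add_zero]
      refine Finset.dvd_sum fun i hi => ?_
      refine Dvd.dvd.mul_right (Dvd.dvd.mul_left (dvd_pow_self _ ?_) _) _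
      simp at hi; omega
  refine ⟨L 0, ⟨L, hcoord, hLh, rfl⟩, hx, fun n => ?_⟩
  refine ImgIdeals.core D d (L 0) (L 1) (L 2) c q hx hL0 hc0 hy hq0 hz ?_ n
  have hvec : ![L 0, L 1, L 2] = L := by
    funext i
    fin_cases i <;> rfl
  rw [hvec]
  exact hsurj
end

section
/- Let k be a field of characteristic zero. If D is a nonzero locally nilpotent derivation on k[X,Y,Z] that is homogeneous with respect to a grading assigning positive weights to X, Y, Z, and there exist algebraically independent homogeneous polynomials F, G with ker(D) = k[F,G], then the Jacobian derivation Δ_{(F,G)} : g ↦ ∂(F,G,g)/∂(X,Y,Z) is locally nilpotent and D = a·Δ_{(F,G)} for some a ∈ ker(D). -/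
open MvPolynomial

namespace DaigleAux

set_option linter.unusedSectionVars false

section LND
variable {k B : Type*} [Field k] [CharZero k] [CommRing B] [IsDomain B] [Algebra k B]

lemma iter_zero (D : Derivation k B B) (n : ℕ) : (⇑D)^[n] 0 = 0 :=
  Function.iterate_fixed (map_zero D) n

lemma iter_add (D : Derivation k B B) (n : ℕ) (x y : B) :
    (⇑D)^[n] (x + y) = (⇑D)^[n] x + (⇑D)^[n] y := by
  induction n generalizing x y with
  | zero => rfl
  | succ n ih => simp only [Function.iterate_succ_apply, map_add, ih]

lemma iter_mul_const (D : Derivation k B B) (n : ℕ) (x y : B) (hx : D x = 0) :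
    (⇑D)^[n] (x * y) = x * (⇑D)^[n] y := by
  induction n generalizing y with
  | zero => rfl
  | succ n ih =>
    simp only [Function.iterate_succ_apply]
    rw [Derivation.leibniz, hx, smul_zero, add_zero, smul_eq_mul, ih]

/-- Leading term of the iterated Leibniz rule. -/
lemma iter_mul (D : Derivation k B B) (s : ℕ) : ∀ (m n : ℕ) (x y : B), m + n = s →
    (⇑D)^[m + 1] x = 0 → (⇑D)^[n + 1] y = 0 →
    (⇑D)^[s] (x * y) = (Nat.choose (m + n) m : B) * ((⇑D)^[m] x * (⇑D)^[n] y) := by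
  induction s with
  | zero =>
    intro m n x y h _ _
    obtain ⟨rfl, rfl⟩ : m = 0 ∧ n = 0 := by omega
    simp
  | succ s ih =>
    intro m n x y h hx hy
    rcases m with _ | m
    · have hx' : D x = 0 := hx
      rw [iter_mul_const D _ _ _ hx']
      obtain rfl : n = s + 1 := by omega
      simp
    rcases n with _ | n
    · have hy' : D y = 0 := hy
      rw [mul_comm, iter_mul_const D _ _ _ hy']
      obtain rfl : m = s := by omega
      simp [mul_comm]
    · have h1 := ih (m + 1) n x (D y) (by omega) hx hy
      have h2 := ih m (n + 1) (D x) y (by omega) hx hy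
      rw [Function.iterate_succ_apply, Derivation.leibniz, iter_add, smul_eq_mul, smul_eq_mul,
        h1, mul_comm y, h2, ← Function.iterate_succ_apply, ← Function.iterate_succ_apply]
      have : (m + 1 + (n + 1)).choose (m + 1)
          = (m + (n + 1)).choose m + (m + 1 + n).choose (m + 1) := by
        rw [show m + 1 + (n + 1) = (m + (n + 1)) + 1 by omega, Nat.choose_succ_succ,
          show m + 1 + n = m + (n + 1) by omega]
      rw [this]
      push_cast
      ring

lemma exists_deg (D : Derivation k B B) (hD : IsLND D) (x : B) (hx : x ≠ 0) :
    ∃ m, (⇑D)^[m] x ≠ 0 ∧ (⇑D)^[m + 1] x = 0 := by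
  classical
  have h := hD x
  have h0 : Nat.find h ≠ 0 := by
    intro h0
    have := Nat.find_spec h
    rw [h0] at this
    exact hx this
  obtain ⟨m, hm⟩ := Nat.exists_eq_succ_of_ne_zero h0
  refine ⟨m, Nat.find_min h (by omega), ?_⟩
  have := Nat.find_spec h
  rwa [hm] at this

lemma mul_deg (D : Derivation k B B) {m n : ℕ} {x y : B}
    (hx : (⇑D)^[m] x ≠ 0) (hx' : (⇑D)^[m + 1] x = 0)
    (hy : (⇑D)^[n] y ≠ 0) (hy' : (⇑D)^[n + 1] y = 0) : (⇑D)^[m + n] (x * y) ≠ 0 := by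
  rw [iter_mul D _ m n x y rfl hx' hy']
  have : CharZero B := charZero_of_injective_algebraMap (algebraMap k B).injective
  refine mul_ne_zero ?_ (mul_ne_zero hx hy)
  exact_mod_cast (Nat.choose_pos (Nat.le_add_right m n)).ne'

/-- Kernels of locally nilpotent derivations are factorially closed. -/
lemma fact_closed (D : Derivation k B B) (hD : IsLND D) {x y : B} (hxy : x * y ≠ 0)
    (h : D (x * y) = 0) : D x = 0 := by
  obtain ⟨m, hm, hm'⟩ := exists_deg D hD x (left_ne_zero_of_mul hxy)
  obtain ⟨n, hn, hn'⟩ := exists_deg D hD y (right_ne_zero_of_mul hxy)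
  have key := mul_deg D hm hm' hn hn'
  rcases m with _ | m
  · exact hm'
  · exfalso
    apply key
    rw [show m + 1 + n = (m + n) + 1 by omega, Function.iterate_succ_apply, h, iter_zero]

lemma eq_zero_of_dvd (D : Derivation k B B) (hD : IsLND D) {x : B} (h : x ∣ D x) : D x = 0 := by
  by_contra h0
  obtain ⟨y, hy⟩ := h
  have hxy : x * y ≠ 0 := hy ▸ h0
  obtain ⟨m, hm, hm'⟩ := exists_deg D hD x (left_ne_zero_of_mul hxy)
  obtain ⟨n, hn, hn'⟩ := exists_deg D hD y (right_ne_zero_of_mul hxy)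
  apply mul_deg D hm hm' hn hn'
  rw [← hy, ← Function.iterate_succ_apply, show (m + n).succ = n + (m + 1) by omega,
    Function.iterate_add_apply, hm', iter_zero]

end LND

section Poly
variable {k : Type*} [Field k] [CharZero k]

lemma pderiv_eq_zero_of_dvd {h : MvPolynomial (Fin 3) k} {i : Fin 3} (hd : h ∣ pderiv i h) :
    pderiv i h = 0 := by
  by_contra h0
  have h1 := totalDegree_le_of_dvd_of_isDomain hd h0
  obtain ⟨m, hm, hm'⟩ := Finset.exists_mem_eq_sup (pderiv i h).support (by simpa using h0)
    (fun m => m.sum fun _ e => e)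
  have h2 : (pderiv i h).totalDegree = m.sum fun _ e => e := hm'
  have h3 : m + Finsupp.single i 1 ∈ h.support := by
    rw [mem_support_iff] at hm ⊢
    rw [coeff_pderiv] at hm
    exact left_ne_zero_of_mul hm
  have h4 := le_totalDegree h3
  rw [Finsupp.sum_add_index' (by simp) (by simp), Finsupp.sum_single_index rfl] at h4
  omega

lemma eq_C_of_pderiv {h : MvPolynomial (Fin 3) k} (hd : ∀ i, pderiv i h = 0) :
    h = C (coeff 0 h) := by
  ext m
  rw [coeff_C]
  split_ifs with hm
  · rw [hm]
  · have : ∃ i, m i ≠ 0 := by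
      by_contra! hc
      exact hm (Finsupp.ext fun i => (hc i).symm)
    obtain ⟨i, hi⟩ := this
    have h1 := coeff_pderiv (i := i) h (m - Finsupp.single i 1)
    rw [hd i, coeff_zero] at h1
    have h2 : m - Finsupp.single i 1 + Finsupp.single i 1 = m := by
      apply tsub_add_cancel_of_le
      rw [Finsupp.single_le_iff]
      omega
    rw [h2] at h1
    rcases mul_eq_zero.1 h1.symm with h3 | h3
    · exact h3
    · exfalso
      exact Nat.cast_add_one_ne_zero _ h3

lemma pderiv_comm' (i j : Fin 3) (f : MvPolynomial (Fin 3) k) :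
    pderiv i (pderiv j f) = pderiv j (pderiv i f) := by
  have : ⁅(pderiv i : Derivation k (MvPolynomial (Fin 3) k) (MvPolynomial (Fin 3) k)),
      (pderiv j : Derivation k (MvPolynomial (Fin 3) k) (MvPolynomial (Fin 3) k))⁆ = 0 := by
    apply derivation_ext
    intro l
    rw [Derivation.commutator_apply]
    simp only [pderiv_X, Pi.single_apply]
    split_ifs <;> simp
  have h := congrArg (fun E => E f) this
  simp only [Derivation.commutator_apply, Derivation.zero_apply] at h
  exact sub_eq_zero.1 h

lemma der_eq (D : Derivation k (MvPolynomial (Fin 3) k) (MvPolynomial (Fin 3) k))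
    (g : MvPolynomial (Fin 3) k) :
    D g = D (X 0) * pderiv 0 g + D (X 1) * pderiv 1 g + D (X 2) * pderiv 2 g := by
  have : D = D (X 0) • pderiv 0 + D (X 1) • pderiv 1 + D (X 2) • pderiv 2 := by
    apply derivation_ext
    intro l
    fin_cases l <;> simp [pderiv_X]
  have h := congrArg (fun E => E g) this
  simpa using h

/-- The Euler derivation attached to a weight. -/
noncomputable def euler (w : Fin 3 → ℤ) :
    Derivation k (MvPolynomial (Fin 3) k) (MvPolynomial (Fin 3) k) :=
  mkDerivation k (fun i => C (w i : k) * X i)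

lemma euler_apply (w : Fin 3 → ℤ) {f : MvPolynomial (Fin 3) k} {n : ℤ}
    (hf : IsWeightedHomogeneous w f n) : euler w f = C (n : k) * f := by
  have hm : ∀ m : Fin 3 →₀ ℕ, ∀ r : k, euler w (monomial m r)
      = C ((Finsupp.weight w m : ℤ) : k) * monomial m r := by
    intro m r
    rw [der_eq, Finsupp.weight_apply, Finsupp.sum_fintype _ _ (by simp), Fin.sum_univ_three]
    simp only [euler, mkDerivation_X, mul_assoc, X_mul_pderiv_monomial]
    simp only [nsmul_eq_mul, Int.cast_add, Int.cast_mul, Int.cast_natCast, map_add, map_mul,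
      map_natCast]
    ring
  conv_lhs => rw [f.as_sum]
  conv_rhs => rw [f.as_sum]
  rw [map_sum, Finset.mul_sum]
  refine Finset.sum_congr rfl fun m hm' => ?_
  rw [hm, hf (mem_support_iff.1 hm')]

lemma weight_ne_zero (w : Fin 3 → ℤ) (hw : ∀ i, 0 < w i) {f : MvPolynomial (Fin 3) k} {n : ℤ}
    (hf : IsWeightedHomogeneous w f n) (hC : ∀ c, f ≠ C c) : n ≠ 0 := by
  rintro rfl
  apply hC (coeff 0 f)
  ext m
  rw [coeff_C]
  split_ifs with hm
  · rw [hm]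
  · by_contra h0
    have h1 := hf h0
    rw [Finsupp.weight_apply, Finsupp.sum_fintype _ _ (by simp)] at h1
    rw [Finset.sum_eq_zero_iff_of_nonneg (fun i _ => by have := hw i; positivity)] at h1
    apply hm
    ext i
    have h2 := h1 i (Finset.mem_univ i)
    have h3 := (hw i).ne'
    simp only [nsmul_eq_mul, mul_eq_zero, h3, or_false, Nat.cast_eq_zero] at h2
    simpa using h2.symm

lemma relPrime_X : IsRelPrime (X 0 : MvPolynomial (Fin 2) k) (X 1) := by
  intro d h0 h1
  have hp : Prime (X 0 : MvPolynomial (Fin 2) k) := X_prime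
  obtain ⟨q, hq⟩ := h0
  rcases hp.irreducible.isUnit_or_isUnit hq with h | h
  · exact h
  · exfalso
    have h2 : (X 0 : MvPolynomial (Fin 2) k) ∣ X 1 := by
      rw [hq]
      exact (h.mul_right_dvd).2 h1
    rw [X_dvd_X] at h2
    exact absurd h2 (by decide)

lemma exists_prim (N : Fin 3 → MvPolynomial (Fin 3) k) :
    ∃ (n : MvPolynomial (Fin 3) k) (P : Fin 3 → MvPolynomial (Fin 3) k),
      (∀ i, N i = n * P i) ∧ ∀ x y, (∀ i, x ∣ y * P i) → x ∣ y := by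
  classical
  let _ : NormalizedGCDMonoid (MvPolynomial (Fin 3) k) :=
    Classical.choice inferInstance
  obtain ⟨P, hP, hP1⟩ := Finset.extract_gcd (s := Finset.univ) N Finset.univ_nonempty
  refine ⟨_, P, fun i => hP i (Finset.mem_univ i), fun x y h => ?_⟩
  have h1 : x ∣ Finset.univ.gcd fun i => y * P i := Finset.dvd_gcd fun i _ => h i
  have h2 := h1.trans (Finset.gcd_mul_left' Finset.univ P y).dvd
  rwa [hP1, mul_one] at h2

lemma grad_adjoin {F G n : MvPolynomial (Fin 3) k} (hn : n ∈ Algebra.adjoin k {F, G}) :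
    ∃ a b, ∀ i, pderiv i n = a * pderiv i F + b * pderiv i G := by
  induction hn using Algebra.adjoin_induction with
  | mem x hx =>
    rcases hx with rfl | rfl
    · exact ⟨1, 0, fun i => by ring⟩
    · exact ⟨0, 1, fun i => by ring⟩
  | algebraMap r => exact ⟨0, 0, fun i => by simp [algebraMap_eq]⟩
  | add x y _ _ hx hy =>
    obtain ⟨a, b, h⟩ := hx
    obtain ⟨c, d, h'⟩ := hy
    exact ⟨a + c, b + d, fun i => by rw [map_add, h, h']; ring⟩
  | mul x y _ _ hx hy =>
    obtain ⟨a, b, h⟩ := hx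
    obtain ⟨c, d, h'⟩ := hy
    exact ⟨a * y + x * c, b * y + x * d, fun i => by rw [pderiv_mul, h, h']; ring⟩

/-- `∇F × ∇G`. -/
noncomputable def crossGrad (F G : MvPolynomial (Fin 3) k) : Fin 3 → MvPolynomial (Fin 3) k :=
  ![pderiv 1 F * pderiv 2 G - pderiv 2 F * pderiv 1 G,
    pderiv 2 F * pderiv 0 G - pderiv 0 F * pderiv 2 G,
    pderiv 0 F * pderiv 1 G - pderiv 1 F * pderiv 0 G]

lemma jac_eq (F G g : MvPolynomial (Fin 3) k) : jac F G g =
    crossGrad F G 0 * pderiv 0 g + crossGrad F G 1 * pderiv 1 g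
      + crossGrad F G 2 * pderiv 2 g := by
  simp only [jac, Matrix.det_fin_three, crossGrad, Matrix.of_apply, Matrix.cons_val]
  ring

/-- If `d` divides `∇F × ∇G`, then `d` divides `E(F) ∇G - E(G) ∇F`. -/
lemma dvd_contract (w : Fin 3 → ℤ) {F G d : MvPolynomial (Fin 3) k}
    (h : ∀ i, d ∣ crossGrad F G i) (i : Fin 3) :
    d ∣ euler w F * pderiv i G - euler w G * pderiv i F := by
  have h0 := h 0
  have h1 := h 1
  have h2 := h 2
  simp only [crossGrad, Matrix.cons_val] at h0 h1 h2
  obtain ⟨a, ha⟩ := h0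
  obtain ⟨b, hb⟩ := h1
  obtain ⟨c, hc⟩ := h2
  rw [der_eq (euler w) F, der_eq (euler w) G]
  generalize (euler w (X 0) : MvPolynomial (Fin 3) k) = e0
  generalize (euler w (X 1) : MvPolynomial (Fin 3) k) = e1
  generalize (euler w (X 2) : MvPolynomial (Fin 3) k) = e2
  fin_cases i
  · exact ⟨e2 * b - e1 * c, by simp only [Fin.zero_eta, Fin.isValue]; linear_combination e2 * hb - e1 * hc⟩
  · exact ⟨e0 * c - e2 * a, by simp only [Fin.mk_one, Fin.isValue]; linear_combination e0 * hc - e2 * ha⟩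
  · exact ⟨e1 * a - e0 * b, by simp only [Fin.reduceFinMk, Fin.isValue]; linear_combination e1 * ha - e0 * hb⟩

lemma crossGrad_homog (w : Fin 3 → ℤ) {F G : MvPolynomial (Fin 3) k} {f g : ℤ}
    (hF : IsWeightedHomogeneous w F f) (hG : IsWeightedHomogeneous w G g) (i : Fin 3) :
    ∃ m : ℤ, IsWeightedHomogeneous w (crossGrad F G i) m := by
  have hF' : ∀ i, IsWeightedHomogeneous w (pderiv i F) (f - w i) :=
    fun i => hF.pderiv (by ring)
  have hG' : ∀ i, IsWeightedHomogeneous w (pderiv i G) (g - w i) :=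
    fun i => hG.pderiv (by ring)
  have key : ∀ i j, IsWeightedHomogeneous w
      (pderiv i F * pderiv j G - pderiv j F * pderiv i G) (f - w i + (g - w j)) := by
    intro i j
    refine ((hF' i).mul (hG' j)).sub ?_
    have := (hF' j).mul (hG' i)
    rwa [show f - w j + (g - w i) = f - w i + (g - w j) by ring] at this
  fin_cases i
  · exact ⟨_, key 1 2⟩
  · exact ⟨_, key 2 0⟩
  · exact ⟨_, key 0 1⟩

lemma crossGrad_div (F G : MvPolynomial (Fin 3) k) :
    pderiv 0 (crossGrad F G 0) + pderiv 1 (crossGrad F G 1) + pderiv 2 (crossGrad F G 2) = 0 := by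
  simp only [crossGrad, Matrix.cons_val, map_sub, pderiv_mul]
  rw [pderiv_comm' 1 0 F, pderiv_comm' 1 0 G, pderiv_comm' 2 0 F, pderiv_comm' 2 0 G,
    pderiv_comm' 2 1 F, pderiv_comm' 2 1 G]
  ring

end Poly

end DaigleAux

open DaigleAux

/-- Daigle's theorem for `n = 3`: if `D` is a nonzero LND on `k[X,Y,Z]`, homogeneous
with respect to a positive grading, whose kernel is `k[F,G]` for algebraically
independent weighted-homogeneous `F, G`, then the Jacobian derivation `Δ_{(F,G)}`
is locally nilpotent and `D = a·Δ_{(F,G)}` for some `a ∈ ker D`. -/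
theorem lnd_is_multiple_of_jacobian {k : Type*} [Field k] [CharZero k]
    (w : Fin 3 → ℤ) (hw : ∀ i, 0 < w i)
    (D : Derivation k (MvPolynomial (Fin 3) k) (MvPolynomial (Fin 3) k))
    (hD : D ≠ 0) (hlnd : IsLND D)
    (dd : ℤ)
    (hhom : ∀ (i : ℤ) (f : MvPolynomial (Fin 3) k),
      MvPolynomial.IsWeightedHomogeneous w f i →
      MvPolynomial.IsWeightedHomogeneous w (D f) (i + dd))
    (F G : MvPolynomial (Fin 3) k)
    (hF : ∃ i : ℤ, MvPolynomial.IsWeightedHomogeneous w F i)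
    (hG : ∃ j : ℤ, MvPolynomial.IsWeightedHomogeneous w G j)
    (halg : AlgebraicIndependent k ![F, G])
    (hker : {b | D b = 0}
      = ↑(Algebra.adjoin k ({F, G} : Set (MvPolynomial (Fin 3) k)))) :
    (∀ g : MvPolynomial (Fin 3) k, ∃ m : ℕ, (fun g => jac F G g)^[m] g = 0) ∧
    ∃ a : MvPolynomial (Fin 3) k, D a = 0 ∧ ∀ g, D g = a * jac F G g := by
  obtain ⟨f, hF⟩ := hF
  obtain ⟨g, hG⟩ := hG
  have hmem : ∀ b, D b = 0 ↔ b ∈ Algebra.adjoin k ({F, G} : Set (MvPolynomial (Fin 3) k)) :=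
    fun b => Set.ext_iff.1 hker b
  have hDF : D F = 0 := (hmem F).2 (Algebra.subset_adjoin (by simp))
  have hDG : D G = 0 := (hmem G).2 (Algebra.subset_adjoin (by simp))
  have hF0 : F ≠ 0 := halg.ne_zero 0
  have hG0 : G ≠ 0 := halg.ne_zero 1
  have hFC : ∀ c, F ≠ C c := by
    intro c hc
    have h1 := (halg.transcendental 0)
    apply h1
    change IsAlgebraic k F
    rw [hc]
    exact isAlgebraic_algebraMap c
  have hGC : ∀ c, G ≠ C c := by
    intro c hc
    have h1 := (halg.transcendental 1)
    apply h1
    change IsAlgebraic k G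
    rw [hc]
    exact isAlgebraic_algebraMap c
  have hf : (f : k) ≠ 0 := by exact_mod_cast weight_ne_zero w hw hF hFC
  have hg : (g : k) ≠ 0 := by exact_mod_cast weight_ne_zero w hw hG hGC
  have hEF := euler_apply w hF
  have hEG := euler_apply w hG
  have hCf : IsUnit (C (f : k) : MvPolynomial (Fin 3) k) := hf.isUnit.map C
  have hCg : IsUnit (C (g : k) : MvPolynomial (Fin 3) k) := hg.isUnit.map C
  -- `F` and `G` are coprime
  have hlift : ∀ b, D b = 0 → ∃ H : MvPolynomial (Fin 2) k, aeval ![F, G] H = b := by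
    intro b hb
    have h1 := (hmem b).1 hb
    have h2 : ({F, G} : Set (MvPolynomial (Fin 3) k)) = Set.range ![F, G] := by simp [Set.pair_comm]
    rw [h2, Algebra.adjoin_range_eq_range_aeval] at h1
    exact h1
  have hinj : Function.Injective (aeval ![F, G] : MvPolynomial (Fin 2) k →ₐ[k] _) := halg
  have hcop : IsRelPrime F G := by
    rintro h ⟨q, hq⟩ ⟨r, hr⟩
    have hDh : D h = 0 := fact_closed D hlnd (hq ▸ hF0) (hq ▸ hDF)
    have hDq : D q = 0 := by
      rw [mul_comm] at hq
      exact fact_closed D hlnd (hq ▸ hF0) (hq ▸ hDF)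
    have hDr : D r = 0 := by
      rw [mul_comm] at hr
      exact fact_closed D hlnd (hr ▸ hG0) (hr ▸ hDG)
    obtain ⟨H, rfl⟩ := hlift h hDh
    obtain ⟨Q, rfl⟩ := hlift q hDq
    obtain ⟨R, rfl⟩ := hlift r hDr
    have h1 : X 0 = H * Q := hinj (by rw [map_mul, ← hq, aeval_X]; rfl)
    have h2 : X 1 = H * R := hinj (by rw [map_mul, ← hr, aeval_X]; rfl)
    exact (relPrime_X ⟨Q, h1⟩ ⟨R, h2⟩).map (aeval ![F, G])
  -- the Jacobian derivation is nonzero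
  have hN : ∃ i, crossGrad F G i ≠ 0 := by
    by_contra! hN
    have h1 : ∀ i, F ∣ pderiv i F := by
      intro i
      have h2 := dvd_contract w (d := 0) (fun i => by rw [hN i]) i
      rw [zero_dvd_iff, hEF, hEG] at h2
      have h3 : F ∣ G * pderiv i F := by
        rw [← hCg.dvd_mul_left]
        exact ⟨C (f : k) * pderiv i G, by linear_combination -h2⟩
      exact hcop.dvd_of_dvd_mul_left h3
    exact hFC _ (eq_C_of_pderiv fun i => pderiv_eq_zero_of_dvd (h1 i))
  obtain ⟨n, P, hNP, hP⟩ := exists_prim (crossGrad F G)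
  have hn0 : n ≠ 0 := by
    rintro rfl
    obtain ⟨i, hi⟩ := hN
    exact hi (by rw [hNP, zero_mul])
  -- `D` is a multiple of the primitive part
  have hDF' := hDF
  have hDG' := hDG
  rw [der_eq] at hDF' hDG'
  have hcross : ∀ i j, D (X i) * P j = D (X j) * P i := by
    have hN' : ∀ i j, D (X i) * crossGrad F G j = D (X j) * crossGrad F G i := by
      have h01 : D (X 0) * crossGrad F G 1 = D (X 1) * crossGrad F G 0 := by
        simp only [crossGrad, Matrix.cons_val]
        linear_combination pderiv 2 F * hDG' - pderiv 2 G * hDF'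
      have h02 : D (X 0) * crossGrad F G 2 = D (X 2) * crossGrad F G 0 := by
        simp only [crossGrad, Matrix.cons_val]
        linear_combination - pderiv 1 F * hDG' + pderiv 1 G * hDF'
      have h12 : D (X 1) * crossGrad F G 2 = D (X 2) * crossGrad F G 1 := by
        simp only [crossGrad, Matrix.cons_val]
        linear_combination pderiv 0 F * hDG' - pderiv 0 G * hDF'
      intro i j
      fin_cases i <;> fin_cases j
      exacts [Eq.refl _, h01, h02, h01.symm, Eq.refl _, h12, h02.symm, h12.symm, Eq.refl _]
    intro i j
    apply mul_left_cancel₀ hn0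
    have := hN' i j
    rw [hNP, hNP] at this
    linear_combination this
  obtain ⟨i₀, hi₀⟩ := hN
  have hP0 : P i₀ ≠ 0 := by
    intro h
    exact hi₀ (by rw [hNP, h, mul_zero])
  obtain ⟨a, ha⟩ : P i₀ ∣ D (X i₀) := hP _ _ fun j => ⟨D (X j), by rw [hcross]; ring⟩
  have hDP : ∀ j, D (X j) = a * P j := by
    intro j
    apply mul_left_cancel₀ hP0
    have := hcross i₀ j
    rw [ha] at this
    linear_combination -this
  -- `n` lies in the kernel of `D`
  have hDn : D n = 0 := by
    apply eq_zero_of_dvd D hlnd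
    rw [der_eq, hDP, hDP, hDP]
    have h1 := crossGrad_div F G
    rw [hNP, hNP, hNP, pderiv_mul, pderiv_mul, pderiv_mul] at h1
    exact ⟨-a * (pderiv 0 (P 0) + pderiv 1 (P 1) + pderiv 2 (P 2)), by
      linear_combination a * h1⟩
  -- `n` divides `E n`
  have hEn : n ∣ euler w n := by
    apply hP
    intro i
    obtain ⟨m, hm⟩ := crossGrad_homog w hF hG i
    have h1 := euler_apply w hm
    rw [hNP, Derivation.leibniz, smul_eq_mul, smul_eq_mul] at h1
    exact ⟨C (m : k) * P i - euler w (P i), by linear_combination h1⟩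
  obtain ⟨α, β, hαβ⟩ := grad_adjoin ((hmem n).1 hDn)
  have hnF : ∀ i, n ∣ F * pderiv i n := by
    intro i
    have h1 : ∀ j, n ∣ crossGrad F n j := by
      intro j
      have h2 : crossGrad F n j = β * crossGrad F G j := by
        fin_cases j <;> simp only [crossGrad, hαβ, Fin.zero_eta, Fin.mk_one, Fin.reduceFinMk,
          Fin.isValue, Matrix.cons_val] <;> ring
      rw [h2, hNP]
      exact ⟨β * P j, by ring⟩
    have h3 := dvd_contract w h1 i
    rw [hEF] at h3
    have h4 := dvd_add h3 (hEn.mul_right (pderiv i F))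
    rw [sub_add_cancel, mul_assoc, hCf.dvd_mul_left] at h4
    exact h4
  have hnG : ∀ i, n ∣ G * pderiv i n := by
    intro i
    have h1 : ∀ j, n ∣ crossGrad G n j := by
      intro j
      have h2 : crossGrad G n j = -α * crossGrad F G j := by
        fin_cases j <;> simp only [crossGrad, hαβ, Fin.zero_eta, Fin.mk_one, Fin.reduceFinMk,
          Fin.isValue, Matrix.cons_val] <;> ring
      rw [h2, hNP]
      exact ⟨-α * P j, by ring⟩
    have h3 := dvd_contract w h1 i
    rw [hEG] at h3
    have h4 := dvd_add h3 (hEn.mul_right (pderiv i G))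
    rw [sub_add_cancel, mul_assoc, hCg.dvd_mul_left] at h4
    exact h4
  have hnn : ∀ i, n ∣ pderiv i n := by
    intro i
    obtain ⟨u, hu⟩ := hnF i
    obtain ⟨v, hv⟩ := hnG i
    have h1 : F * v = G * u := by
      apply mul_left_cancel₀ hn0
      linear_combination G * hu - F * hv
    obtain ⟨t, ht⟩ : F ∣ u := hcop.dvd_of_dvd_mul_left ⟨v, h1.symm⟩
    refine ⟨t, mul_left_cancel₀ hF0 ?_⟩
    rw [hu, ht]
    ring
  have hnC := eq_C_of_pderiv fun i => pderiv_eq_zero_of_dvd (hnn i)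
  have hc0 : coeff 0 n ≠ 0 := by
    intro h
    rw [h, map_zero] at hnC
    exact hn0 hnC
  obtain ⟨n', hn'⟩ : ∃ n', n' * n = 1 := ⟨C (coeff 0 n)⁻¹, by
    conv_lhs => rw [hnC]
    rw [coeff_C, if_pos rfl, ← C_mul, inv_mul_cancel₀ hc0, C_1]⟩
  have hfin : ∀ h, D h = (a * n') * jac F G h := by
    intro h
    rw [der_eq, jac_eq, hDP, hDP, hDP, hNP, hNP, hNP]
    linear_combination -(a * (P 0 * pderiv 0 h + P 1 * pderiv 1 h + P 2 * pderiv 2 h)) * hn'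
  generalize a * n' = b at hfin
  have hDb : D b = 0 := eq_zero_of_dvd D hlnd ⟨_, hfin b⟩
  refine ⟨?_, b, hDb, hfin⟩
  have hb0 : b ≠ 0 := by
    rintro rfl
    exact hD (Derivation.ext fun x => by rw [hfin, zero_mul]; rfl)
  have hiter : ∀ (m : ℕ) (x : MvPolynomial (Fin 3) k),
      (⇑D)^[m] x = b ^ m * (fun g => jac F G g)^[m] x := by
    intro m
    induction m with
    | zero => intro x; simp
    | succ m ih =>
      intro x
      rw [Function.iterate_succ_apply, hfin, iter_mul_const D _ _ _ hDb, ih,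
        Function.iterate_succ_apply]
      ring
  intro x
  obtain ⟨m, hm⟩ := hlnd x
  refine ⟨m, ?_⟩
  rw [hiter] at hm
  exact (mul_eq_zero.1 hm).resolve_left (pow_ne_zero _ hb0)
end
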